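/- arXiv:1804.09105 — 4 statements merged into one kernel-verified Lean document; each statement's English description precedes it below -/
import Mathlib

section
/- Fix M > 0, a node i, and vectors λ_ij, λ_ji ∈ ℝ^S for j ∈ N_i, and set d_i = ∑_{j∈N_i}(λ_ij − λ_ji). The max-min problem max over 0 ⪯ μ_i ⪯ M·1 of min over x_i ∈ X_i of ( f_i(x_i) + μ_iᵀ( g_i(x_i) + d_i ) ) is the saddle-point problem associated with the constrained problem: minimize f_i(x_i) + M·1ᵀρ_i over x_i ∈ X_i, ρ_i ⪰ 0, subject to g_i(x_i) + d_i ⪯ ρ_i. Moreover a finite primal–dual optimal solution pair ((x_i*, ρ_i*), μ_i*) of this constrained problem exists, and (x_i*, μ_i*) attains the max-min value, which equals the optimal value of the constrained problem. -/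
/-- The Lagrangian `f(x) + μᵀ(g(x) + d)` has a saddle point over a nonempty compact convex set of
primal points and the box `0 ⪯ μ ⪯ M·1`. -/
lemma exists_isSaddlePointOn_box {ι E : Type*} [Fintype ι]
    [TopologicalSpace E] [AddCommGroup E] [Module ℝ E] [IsTopologicalAddGroup E]
    [ContinuousSMul ℝ E] {X : Set E} {f : E → ℝ} {g : E → ι → ℝ}
    (hXne : X.Nonempty) (hXcp : IsCompact X) (hXcv : Convex ℝ X)
    (hf : ConvexOn ℝ X f) (hfc : ContinuousOn f X)
    (hg : ∀ s, ConvexOn ℝ X (fun x => g x s))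
    (hgc : ∀ s, ContinuousOn (fun x => g x s) X)
    {M : ℝ} (hM : 0 ≤ M) (d : ι → ℝ) :
    ∃ a ∈ X, ∃ b ∈ Set.Icc (0 : ι → ℝ) (fun _ => M),
      IsSaddlePointOn X (Set.Icc (0 : ι → ℝ) (fun _ => M))
        (fun x ν => f x + ∑ s, ν s * (g x s + d s)) a b := by
  refine Sion.exists_isSaddlePointOn hXne hXcv hXcp ?_ ?_ (convex_Icc _ _)
    ⟨0, le_rfl, fun _ => hM⟩ isCompact_Icc ?_ ?_
  · intro ν _
    exact ContinuousOn.lowerSemicontinuousOn (by fun_prop)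
  · intro ν hν
    refine ConvexOn.quasiconvexOn (hf.add ?_)
    refine ⟨hXcv, fun x hx y hy a b ha hb hab => ?_⟩
    simp only [smul_eq_mul, Finset.mul_sum, ← Finset.sum_add_distrib]
    refine Finset.sum_le_sum fun s _ => ?_
    have h := mul_le_mul_of_nonneg_left ((hg s).2 hx hy ha hb hab) (hν.1 s)
    simp only [smul_eq_mul] at h
    have hd : ν s * d s = (a + b) * (ν s * d s) := by rw [hab, one_mul]
    linarith
  · intro x _
    exact (by fun_prop : Continuous fun ν : ι → ℝ => f x + ∑ s, ν s * (g x s + d s))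
      |>.continuousOn.upperSemicontinuousOn
  · intro x _
    refine ConcaveOn.quasiconcaveOn ⟨convex_Icc _ _, fun ν _ μ _ a b _ _ hab => le_of_eq ?_⟩
    have hx : f x = (a + b) * f x := by rw [hab, one_mul]
    simp only [smul_eq_mul, Pi.add_apply, Pi.smul_apply, add_mul, Finset.sum_add_distrib,
      mul_add, Finset.mul_sum, mul_assoc] at hx ⊢
    linarith

/-- A maximizer of `ν ↦ νᵀh` over the box `0 ⪯ ν ⪯ M·1` has value `M·1ᵀh⁺`. -/
lemma sum_mul_eq_of_isMaxOn_box {ι : Type*} [Fintype ι] {M : ℝ} (hM : 0 ≤ M) {h μ : ι → ℝ}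
    (hμ0 : ∀ s, 0 ≤ μ s) (hμM : ∀ s, μ s ≤ M)
    (hmax : ∀ ν : ι → ℝ, (∀ s, 0 ≤ ν s ∧ ν s ≤ M) → ∑ s, ν s * h s ≤ ∑ s, μ s * h s) :
    ∑ s, μ s * h s = M * ∑ s, max (h s) 0 := by
  rw [Finset.mul_sum]
  apply le_antisymm
  · exact Finset.sum_le_sum fun s _ =>
      (mul_le_mul_of_nonneg_left (le_max_left _ _) (hμ0 s)).trans
        (mul_le_mul_of_nonneg_right (hμM s) (le_max_right _ _))
  · refine le_trans (le_of_eq ?_) (hmax (fun s => if 0 ≤ h s then M else 0) fun s => ?_)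
    · refine Finset.sum_congr rfl fun s _ => ?_
      split_ifs with hs
      · rw [max_eq_left hs]
      · rw [max_eq_right (le_of_not_ge hs)]; ring
    · split_ifs <;> simp [hM]

/-- Lemma 4, the local max-min problem as a saddle-point problem.
Fix `M > 0`, a node `i` and `d = ∑_{j∈Nᵢ}(λ_{ij} − λ_{ji})`. The max-min problem
`max_{0⪯μ⪯M·1} min_{x∈X} ( f(x) + μᵀ(g(x)+d) )` is the saddle point problem of
the constrained problem `min f(x) + M·1ᵀρ` over `x ∈ X`, `ρ ⪰ 0`, subject to
`g(x) + d ⪯ ρ`. A finite primal–dual optimal solution pair `((x⋆,ρ⋆),μ⋆)`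
(a saddle point of the Lagrangian) exists, `(x⋆,μ⋆)` solves the max-min
problem, and the common value is the optimal value of the constrained
problem. -/
theorem local_maxmin_saddle_point
    (S ni : ℕ) (hS : 0 < S)
    (X : Set (Fin ni → ℝ))
    (f : (Fin ni → ℝ) → ℝ)
    (g : (Fin ni → ℝ) → Fin S → ℝ)
    (hXne : X.Nonempty) (hXcp : IsCompact X) (hXcv : Convex ℝ X)
    (hf : ConvexOn ℝ X f) (hfc : ContinuousOn f X)
    (hg : ∀ s, ConvexOn ℝ X (fun x => g x s))
    (hgc : ∀ s, ContinuousOn (fun x => g x s) X)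
    (M : ℝ) (hM : 0 < M)
    (d : Fin S → ℝ) :
    ∃ (xstar : Fin ni → ℝ) (ρstar μstar : Fin S → ℝ),
      xstar ∈ X ∧ (∀ s, 0 ≤ ρstar s) ∧ (∀ s, 0 ≤ μstar s) ∧
      -- ((x⋆,ρ⋆),μ⋆) is a saddle point of the Lagrangian of the constrained problem
      (∀ ν : Fin S → ℝ, (∀ s, 0 ≤ ν s) →
        f xstar + M * (∑ s, ρstar s) + ∑ s, ν s * (g xstar s + d s - ρstar s)
          ≤ f xstar + M * (∑ s, ρstar s)
            + ∑ s, μstar s * (g xstar s + d s - ρstar s)) ∧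
      (∀ x ∈ X, ∀ ρ : Fin S → ℝ, (∀ s, 0 ≤ ρ s) →
        f xstar + M * (∑ s, ρstar s) + ∑ s, μstar s * (g xstar s + d s - ρstar s)
          ≤ f x + M * (∑ s, ρ s) + ∑ s, μstar s * (g x s + d s - ρ s)) ∧
      -- (x⋆,μ⋆) is a saddle point (solution) of the max-min problem
      (∀ s, μstar s ≤ M) ∧
      (∀ ν : Fin S → ℝ, (∀ s, 0 ≤ ν s ∧ ν s ≤ M) →
        f xstar + ∑ s, ν s * (g xstar s + d s)
          ≤ f xstar + ∑ s, μstar s * (g xstar s + d s)) ∧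
      (∀ x ∈ X,
        f xstar + ∑ s, μstar s * (g xstar s + d s)
          ≤ f x + ∑ s, μstar s * (g x s + d s)) ∧
      -- the max-min value equals the optimal value of the constrained problem
      f xstar + ∑ s, μstar s * (g xstar s + d s)
        = sSup ((fun ν : Fin S → ℝ =>
            sInf ((fun x => f x + ∑ s, ν s * (g x s + d s)) '' X))
          '' {ν : Fin S → ℝ | ∀ s, 0 ≤ ν s ∧ ν s ≤ M}) ∧
      f xstar + ∑ s, μstar s * (g xstar s + d s)
        = sInf {c | ∃ x ∈ X, ∃ ρ : Fin S → ℝ, (∀ s, 0 ≤ ρ s) ∧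
            (∀ s, g x s + d s ≤ ρ s) ∧ c = f x + M * (∑ s, ρ s)} := by
  obtain ⟨a, ha, μ, hμ, hsad⟩ :=
    exists_isSaddlePointOn_box hXne hXcp hXcv hf hfc hg hgc hM.le d
  have hmax : ∀ ν : Fin S → ℝ, (∀ s, 0 ≤ ν s ∧ ν s ≤ M) →
      f a + ∑ s, ν s * (g a s + d s) ≤ f a + ∑ s, μ s * (g a s + d s) :=
    fun ν hν => hsad a ha ν ⟨fun s => (hν s).1, fun s => (hν s).2⟩
  have hmin : ∀ x ∈ X, f a + ∑ s, μ s * (g a s + d s) ≤ f x + ∑ s, μ s * (g x s + d s) :=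
    fun x hx => hsad x hx μ hμ
  have hval : ∑ s, μ s * (g a s + d s) = M * ∑ s, max (g a s + d s) 0 :=
    sum_mul_eq_of_isMaxOn_box hM.le hμ.1 hμ.2 fun ν hν => by linarith [hmax ν hν]
  have hμM : ∀ ρ : Fin S → ℝ, (∀ s, 0 ≤ ρ s) → ∑ s, μ s * ρ s ≤ M * ∑ s, ρ s := by
    intro ρ hρ
    rw [Finset.mul_sum]
    exact Finset.sum_le_sum fun s _ => mul_le_mul_of_nonneg_right (hμ.2 s) (hρ s)
  have hslack : ∀ ν : Fin S → ℝ, (∀ s, 0 ≤ ν s) →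
      ∑ s, ν s * (g a s + d s - max (g a s + d s) 0) ≤ 0 := fun ν hν =>
    Finset.sum_nonpos fun s _ =>
      mul_nonpos_of_nonneg_of_nonpos (hν s) (sub_nonpos.2 (le_max_left _ _))
  have hρ0 : ∀ s, 0 ≤ max (g a s + d s) 0 := fun s => le_max_right _ _
  refine ⟨a, fun s => max (g a s + d s) 0, μ, ha, hρ0, hμ.1, ?_, ?_, hμ.2, hmax, hmin, ?_, ?_⟩
  · intro ν hν
    have h := hslack ν hν
    have hcomp : 0 ≤ ∑ s, μ s * (g a s + d s - max (g a s + d s) 0) := by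
      simp only [mul_sub _ (_ + _), Finset.sum_sub_distrib]
      linarith [hμM _ hρ0]
    linarith
  · intro x hx ρ hρ
    have h := hslack μ hμ.1
    simp only [mul_sub _ (g x _ + _), Finset.sum_sub_distrib]
    linarith [hμM ρ hρ, hmin x hx]
  · symm
    refine IsGreatest.csSup_eq ⟨⟨μ, fun s => ⟨hμ.1 s, hμ.2 s⟩, ?_⟩, ?_⟩
    · refine IsLeast.csInf_eq ⟨⟨a, ha, rfl⟩, ?_⟩
      rintro _ ⟨x, hx, rfl⟩
      exact hmin x hx
    · rintro _ ⟨ν, hν, rfl⟩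
      refine (csInf_le (hXcp.bddBelow_image ?_) (Set.mem_image_of_mem _ ha)).trans (hmax ν hν)
      fun_prop
  · symm
    refine IsLeast.csInf_eq ⟨⟨a, ha, _, hρ0, fun s => le_max_left _ _, by rw [hval]⟩, ?_⟩
    rintro _ ⟨x, hx, ρ, hρ, hgρ, rfl⟩
    have h : ∑ s, μ s * (g x s + d s) ≤ ∑ s, μ s * ρ s :=
      Finset.sum_le_sum fun s _ => mul_le_mul_of_nonneg_left (hgρ s) (hμ.1 s)
    linarith [hμM ρ hρ, hmin x hx]
end

section
/- Let μ* be an optimal solution of the dual problem and let M > 0 satisfy M > ‖μ*‖_∞. Let G be a connected undirected graph on {1,…,N} with symmetric edge set E. Then the problem min over Λ ∈ ℝ^{S·|E|} of η(Λ) has a finite optimal value η*, strong duality holds between this problem and the constrained copies problem (maximize ∑_{i=1}^N q_i(μ_i) subject to 0 ⪯ μ_i ⪯ M·1 and μ_i = μ_j for (i,j) ∈ E), and moreover η* = f*, the optimal value of the original primal problem. -/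
/-- On a connected graph, every function with zero total is the net outflow of some edge flow. -/
theorem SimpleGraph.Connected.exists_net_flow_eq {V : Type*} [Fintype V] {G : SimpleGraph V}
    [DecidableRel G.Adj] (hG : G.Connected) {δ : V → ℝ} (hδ : ∑ i, δ i = 0) :
    ∃ lam : V → V → ℝ, ∀ i,
      ∑ j ∈ Finset.univ.filter (fun j => G.Adj i j), (lam i j - lam j i) = δ i := by
  classical
  let div : (V → V → ℝ) →ₗ[ℝ] V → ℝ :=
    { toFun := fun lam i => ∑ j ∈ Finset.univ.filter (fun j => G.Adj i j), (lam i j - lam j i)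
      map_add' := by
        intro a b
        ext i
        simp only [Pi.add_apply, ← Finset.sum_add_distrib]
        exact Finset.sum_congr rfl fun j _ => by ring
      map_smul' := by
        intro c a
        ext i
        simp only [Pi.smul_apply, smul_eq_mul, RingHom.id_apply, Finset.mul_sum]
        exact Finset.sum_congr rfl fun j _ => by ring }
  have edge : ∀ u v, G.Adj u v →
      (Pi.single u 1 - Pi.single v 1 : V → ℝ) ∈ LinearMap.range div := by
    intro u v h
    refine ⟨Pi.single u (Pi.single v 1), ?_⟩
    ext i
    change ∑ j ∈ _, _ = _
    rw [Finset.sum_sub_distrib, Finset.sum_filter, Finset.sum_filter]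
    have h1 : ∀ j, (if G.Adj i j then (Pi.single u (Pi.single v 1) : V → V → ℝ) i j else 0)
        = if j = v then (if i = u then 1 else 0) else 0 := by
      intro j
      by_cases hi : i = u
      · subst hi
        by_cases hj : j = v
        · subst hj; simp [h]
        · simp [hj]
      · simp [hi]
    have h2 : ∀ j, (if G.Adj i j then (Pi.single u (Pi.single v 1) : V → V → ℝ) j i else 0)
        = if j = u then (if i = v then 1 else 0) else 0 := by
      intro j
      by_cases hj : j = u
      · subst hj
        by_cases hi : i = v
        · subst hi; simp [h.symm]
        · simp [hi]
      · simp [hj]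
    rw [Finset.sum_congr rfl fun j _ => h1 j, Finset.sum_congr rfl fun j _ => h2 j]
    simp [Pi.single_apply]
  have path : ∀ u v, (Pi.single u 1 - Pi.single v 1 : V → ℝ) ∈ LinearMap.range div := by
    intro u v
    obtain ⟨p⟩ := hG.preconnected u v
    induction p with
    | nil => simp
    | cons h _ ih => simpa using add_mem (edge _ _ h) ih
  obtain ⟨r⟩ := hG.nonempty
  have key : δ = ∑ i, δ i • (Pi.single i 1 - Pi.single r 1 : V → ℝ) := by
    simp only [smul_sub, Finset.sum_sub_distrib, ← Finset.sum_smul, hδ, zero_smul, sub_zero]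
    ext k
    simp [Finset.sum_apply, Pi.single_apply]
  have hmem : δ ∈ LinearMap.range div := by
    rw [key]
    exact sum_mem fun i _ => Submodule.smul_mem _ _ (path i r)
  obtain ⟨lam, hlam⟩ := hmem
  exact ⟨lam, fun i => congrFun hlam i⟩

/-- Lagrange multipliers for a convex program satisfying Slater's condition. -/
theorem ConvexOn.exists_lagrange_multiplier {E σ : Type*} [AddCommGroup E] [Module ℝ E]
    [Fintype σ] {X : Set E} {F : E → ℝ} {H : E → σ → ℝ} (hF : ConvexOn ℝ X F)
    (hH : ∀ s, ConvexOn ℝ X fun x => H x s) (slater : ∃ x ∈ X, ∀ s, H x s < 0) {c : ℝ}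
    (hc : ∀ x ∈ X, (∀ s, H x s ≤ 0) → c ≤ F x) :
    ∃ μ : σ → ℝ, (∀ s, 0 ≤ μ s) ∧ ∀ x ∈ X, c ≤ F x + ∑ s, μ s * H x s := by
  classical
  let A : Set ((σ → ℝ) × ℝ) := {p | ∃ x ∈ X, (∀ s, H x s < p.1 s) ∧ F x < p.2}
  have hAo : IsOpen A := by
    have : A = ⋃ x ∈ X, {p : (σ → ℝ) × ℝ | (∀ s, H x s < p.1 s) ∧ F x < p.2} := by
      ext p
      simp only [A, Set.mem_iUnion, Set.mem_ofPred_eq, exists_prop]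
    rw [this]
    refine isOpen_biUnion fun x _ => ?_
    rw [Set.ofPred_and, Set.ofPred_forall]
    refine (isOpen_iInter_of_finite fun s => ?_).inter ?_
    · exact isOpen_lt continuous_const (by fun_prop)
    · exact isOpen_lt continuous_const (by fun_prop)
  have hAc : Convex ℝ A := by
    rintro p ⟨x, hx, hxH, hxF⟩ p' ⟨y, hy, hyH, hyF⟩ a b ha hb hab
    have comb : ∀ {u v u' v' : ℝ}, u < u' → v < v' → a * u + b * v < a * u' + b * v' := by
      intro u v u' v' h1 h2
      rcases ha.eq_or_lt with rfl | ha'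
      · have : b = 1 := by linarith
        subst this; linarith
      · nlinarith [mul_lt_mul_of_pos_left h1 ha', mul_le_mul_of_nonneg_left h2.le hb]
    refine ⟨a • x + b • y, hF.1 hx hy ha hb hab, fun s => ?_, ?_⟩
    · exact ((hH s).2 hx hy ha hb hab).trans_lt (comb (hxH s) (hyH s))
    · exact (hF.2 hx hy ha hb hab).trans_lt (comb hxF hyF)
  have hcA : ((0 : σ → ℝ), c) ∉ A := by
    rintro ⟨x, hx, hxH, hxF⟩
    exact (hc x hx fun s => (hxH s).le).not_gt hxF
  obtain ⟨l, hl⟩ := geometric_hahn_banach_point_open hAc hAo hcA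
  set r := l (0, 1) with hr
  set w : σ → ℝ := fun s => l (Pi.single s 1, 0) with hw
  have lrep : ∀ v t, l (v, t) = ∑ s, w s * v s + r * t := by
    intro v t
    have : (v, t) = ∑ s, v s • ((Pi.single s 1, 0) : (σ → ℝ) × ℝ) + t • (0, 1) := by
      ext k
      · simp [Prod.fst_sum, Finset.sum_apply, Pi.single_apply]
      · simp [Prod.snd_sum]
    rw [this, map_add, map_sum, map_smul]
    simp only [map_smul, smul_eq_mul, hr, hw, mul_comm]
  simp only [lrep, Pi.zero_apply, mul_zero, Finset.sum_const_zero, zero_add] at hl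
  obtain ⟨x₀, hx₀, hx₀H⟩ := slater
  have hrpos : 0 < r := by
    have := hl (0, max (F x₀) c + 1) ⟨x₀, hx₀, by simpa using hx₀H, by
      linarith [le_max_left (F x₀) c]⟩
    simp only [Pi.zero_apply, mul_zero, Finset.sum_const_zero, zero_add] at this
    nlinarith [le_max_right (F x₀) c]
  have hwnn : ∀ s, 0 ≤ w s := by
    intro s
    by_contra! hneg
    obtain ⟨k, hk⟩ := exists_nat_gt ((r * (F x₀ + 1) - r * c) / (- w s))
    have := hl (Pi.single s (k : ℝ), F x₀ + 1) ⟨x₀, hx₀, fun s' => by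
      have h0 : (0 : ℝ) ≤ (Pi.single s (k : ℝ) : σ → ℝ) s' := by
        rw [Pi.single_apply]; split_ifs <;> positivity
      exact (hx₀H s').trans_le h0, by simp⟩
    rw [div_lt_iff₀ (by linarith)] at hk
    simp only [Pi.single_apply, mul_ite, mul_zero, Finset.sum_ite_eq', Finset.mem_univ,
      if_true] at this
    linarith
  refine ⟨fun s => w s / r, fun s => div_nonneg (hwnn s) hrpos.le, fun x hx => ?_⟩
  have hlim : ∀ ε > 0, r * c ≤ ∑ s, w s * H x s + r * F x + ε * (∑ s, w s + r) := by
    intro ε hε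
    have := hl (fun s => H x s + ε, F x + ε) ⟨x, hx, fun s => by simp [hε], by simp [hε]⟩
    simp only [mul_add, Finset.sum_add_distrib, ← Finset.sum_mul] at this
    linarith
  have hle : r * c ≤ ∑ s, w s * H x s + r * F x := by
    refine le_of_forall_pos_le_add fun ε hε => ?_
    have hK : 0 < ∑ s, w s + r :=
      add_pos_of_nonneg_of_pos (Finset.sum_nonneg fun s _ => hwnn s) hrpos
    have := hlim (ε / (∑ s, w s + r)) (by positivity)
    rwa [div_mul_cancel₀ _ hK.ne'] at this
  have hdiv : ∑ s, w s / r * H x s = (∑ s, w s * H x s) / r := by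
    rw [Finset.sum_div]
    exact Finset.sum_congr rfl fun s _ => by ring
  rw [hdiv, ← sub_le_iff_le_add', le_div_iff₀ hrpos]
  linarith


/-- Lemma 6.
Let `μ⋆` be a dual optimal solution and `M > ‖μ⋆‖_∞` (sup-norm on `Fin S → ℝ`).
Then `min_Λ η(Λ)` has a finite optimal value `η⋆ = sInf (range η)`, strong
duality holds between this problem and the constrained copies problem, and
moreover `η⋆ = f⋆`, the optimal value of the original primal problem. -/
theorem eta_strong_duality_equals_primal
    (N S : ℕ) (hN : 0 < N) (hS : 0 < S)
    (n : Fin N → ℕ)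
    (X : ∀ i : Fin N, Set (Fin (n i) → ℝ))
    (f : ∀ i : Fin N, (Fin (n i) → ℝ) → ℝ)
    (g : ∀ i : Fin N, (Fin (n i) → ℝ) → Fin S → ℝ)
    (hXne : ∀ i, (X i).Nonempty)
    (hXcp : ∀ i, IsCompact (X i))
    (hXcv : ∀ i, Convex ℝ (X i))
    (hf : ∀ i, ConvexOn ℝ Set.univ (f i))
    (hg : ∀ i s, ConvexOn ℝ Set.univ (fun x => g i x s))
    (slater : ∃ xb : ∀ i : Fin N, Fin (n i) → ℝ,
      (∀ i, xb i ∈ X i) ∧ ∀ s, (∑ i, g i (xb i) s) < 0)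
    (qi : Fin N → (Fin S → ℝ) → ℝ)
    (hqi : ∀ i μ, qi i μ =
      sInf ((fun x => f i x + ∑ s, μ s * g i x s) '' X i))
    (q : (Fin S → ℝ) → ℝ) (hq : ∀ μ, q μ = ∑ i, qi i μ)
    (μstar : Fin S → ℝ)
    (hμstar0 : ∀ s, 0 ≤ μstar s)
    (hμstaropt : ∀ μ : Fin S → ℝ, (∀ s, 0 ≤ μ s) → q μ ≤ q μstar)
    (M : ℝ) (hM : 0 < M) (hMμ : ‖μstar‖ < M)
    (G : SimpleGraph (Fin N)) [DecidableRel G.Adj] (hG : G.Connected)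
    (η : (Fin N → Fin N → Fin S → ℝ) → ℝ)
    (hη : ∀ lam, η lam = ∑ i, sSup ((fun μ : Fin S → ℝ =>
        qi i μ + ∑ s, μ s * (∑ j ∈ Finset.univ.filter (fun j => G.Adj i j),
          (lam i j s - lam j i s)))
      '' {μ : Fin S → ℝ | ∀ s, 0 ≤ μ s ∧ μ s ≤ M})) :
    BddBelow (Set.range η) ∧
    sInf (Set.range η)
      = sSup {c | ∃ μ : Fin N → Fin S → ℝ,
          (∀ i s, 0 ≤ μ i s ∧ μ i s ≤ M) ∧
          (∀ i j, G.Adj i j → μ i = μ j) ∧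
          c = ∑ i, qi i (μ i)} ∧
    sInf (Set.range η)
      = sInf {c | ∃ x : ∀ i : Fin N, Fin (n i) → ℝ,
          (∀ i, x i ∈ X i) ∧ (∀ s, (∑ i, g i (x i) s) ≤ 0) ∧
          c = ∑ i, f i (x i)} := by
  have hcont : ∀ i (μ : Fin S → ℝ), Continuous fun x => f i x + ∑ s, μ s * g i x s := by
    intro i μ
    have h1 := (hf i).locallyLipschitz.continuous
    have h2 := fun s => (hg i s).locallyLipschitz.continuous
    fun_prop
  have hqle : ∀ i μ, ∀ x ∈ X i, qi i μ ≤ f i x + ∑ s, μ s * g i x s := by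
    intro i μ x hx
    rw [hqi]
    exact csInf_le ((hXcp i).image (hcont i μ)).bddBelow ⟨x, hx, rfl⟩
  have hqmin : ∀ i μ, ∃ x ∈ X i, qi i μ = f i x + ∑ s, μ s * g i x s := by
    intro i μ
    rw [hqi]
    exact (hXcp i).exists_sInf_image_eq (hXne i) (hcont i μ).continuousOn
  set P : Set ℝ := {c | ∃ x : ∀ i : Fin N, Fin (n i) → ℝ,
    (∀ i, x i ∈ X i) ∧ (∀ s, (∑ i, g i (x i) s) ≤ 0) ∧ c = ∑ i, f i (x i)}
  have hPne : P.Nonempty := by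
    obtain ⟨xb, hxb, hlt⟩ := slater
    exact ⟨_, xb, hxb, fun s => (hlt s).le, rfl⟩
  have hPbdd : BddBelow P := by
    refine ⟨∑ i, qi i 0, ?_⟩
    rintro _ ⟨x, hx, -, rfl⟩
    exact Finset.sum_le_sum fun i _ => by simpa using hqle i 0 (x i) (hx i)
  have strong : sInf P ≤ q μstar := by
    have hXpi : Convex ℝ (Set.univ.pi X) := convex_pi fun i _ => hXcv i
    have hsum : ∀ h : ∀ i, (Fin (n i) → ℝ) → ℝ, (∀ i, ConvexOn ℝ Set.univ (h i)) →
        ConvexOn ℝ (Set.univ.pi X) fun x => ∑ i, h i (x i) := by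
      refine fun h hh => ⟨hXpi, fun x _ y _ a b ha hb hab => ?_⟩
      simp only [smul_eq_mul, Finset.mul_sum, ← Finset.sum_add_distrib]
      exact Finset.sum_le_sum fun i _ => (hh i).2 trivial trivial ha hb hab
    obtain ⟨μ, hμ, hle⟩ := (hsum f hf).exists_lagrange_multiplier
      (H := fun x s => ∑ i, g i (x i) s) (c := sInf P)
      (fun s => hsum (fun i x => g i x s) fun i => hg i s)
      (by
        obtain ⟨xb, hxb, hlt⟩ := slater
        exact ⟨xb, fun i _ => hxb i, hlt⟩)
      (fun x hx hfeas => csInf_le hPbdd ⟨x, fun i => hx i trivial, hfeas, rfl⟩)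
    choose x hx hxq using fun i => hqmin i μ
    calc sInf P ≤ ∑ i, f i (x i) + ∑ s, μ s * ∑ i, g i (x i) s := hle x fun i _ => hx i
      _ = q μ := by
        rw [hq, Finset.sum_congr rfl fun i _ => hxq i, Finset.sum_add_distrib,
          Finset.sum_comm (f := fun i s => μ s * g i (x i) s)]
        simp only [Finset.mul_sum]
      _ ≤ q μstar := hμstaropt μ hμ
  have hbox : ∀ s, 0 ≤ μstar s ∧ μstar s ≤ M := fun s =>
    ⟨hμstar0 s, (le_abs_self _).trans ((norm_le_pi_norm μstar s).trans hMμ.le)⟩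
  have flow_sum : ∀ lam : Fin N → Fin N → Fin S → ℝ, ∀ s,
      ∑ i, ∑ j ∈ Finset.univ.filter (fun j => G.Adj i j), (lam i j s - lam j i s) = 0 := by
    intro lam s
    simp only [Finset.sum_sub_distrib]
    rw [sub_eq_zero]
    simp only [Finset.sum_filter]
    rw [Finset.sum_comm]
    simp only [G.adj_comm]
  have lower : ∀ lam, q μstar ≤ η lam := by
    intro lam
    rw [hη]
    set δ : Fin N → Fin S → ℝ := fun i s =>
      ∑ j ∈ Finset.univ.filter (fun j => G.Adj i j), (lam i j s - lam j i s)
    have hzero : ∑ i, ∑ s, μstar s * δ i s = 0 := by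
      rw [Finset.sum_comm]
      refine Finset.sum_eq_zero fun s _ => ?_
      rw [← Finset.mul_sum, flow_sum, mul_zero]
    have hsplit : q μstar = ∑ i, (qi i μstar + ∑ s, μstar s * δ i s) := by
      rw [Finset.sum_add_distrib, hzero, add_zero, hq]
    rw [hsplit]
    refine Finset.sum_le_sum fun i _ => le_csSup ?_ ⟨μstar, hbox, rfl⟩
    obtain ⟨x, hx⟩ := hXne i
    refine ⟨f i x + ∑ s, M * |g i x s| + ∑ s, M * |δ i s|, ?_⟩
    rintro _ ⟨μ, hμ, rfl⟩
    have hmul : ∀ s (t : ℝ), μ s * t ≤ M * |t| := fun s t =>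
      (mul_le_mul_of_nonneg_left (le_abs_self t) (hμ s).1).trans
        (mul_le_mul_of_nonneg_right (hμ s).2 (abs_nonneg t))
    refine add_le_add ((hqle i μ x hx).trans ?_) (Finset.sum_le_sum fun s _ => hmul s _)
    exact add_le_add_right (Finset.sum_le_sum fun s _ => hmul s _) _
  have upper : ∀ c ∈ P, ∃ lam, η lam ≤ c := by
    rintro _ ⟨x, hx, hfeas, rfl⟩
    have hNpos : (0 : ℝ) < N := Nat.cast_pos.2 hN
    have hflow : ∀ s, ∑ i, ((∑ k, g k (x k) s) / N - g i (x i) s) = 0 := by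
      intro s
      rw [Finset.sum_sub_distrib, Finset.sum_const, Finset.card_univ, Fintype.card_fin,
        nsmul_eq_mul, mul_div_cancel₀ _ hNpos.ne', sub_self]
    choose lam hlam using fun s => hG.exists_net_flow_eq (hflow s)
    refine ⟨fun i j s => lam s i j, ?_⟩
    rw [hη]
    refine Finset.sum_le_sum fun i _ => csSup_le (Set.Nonempty.image _ ⟨μstar, hbox⟩) ?_
    rintro _ ⟨μ, hμ, rfl⟩
    simp only [hlam]
    have hslack : ∑ s, μ s * g i (x i) s + ∑ s, μ s * ((∑ k, g k (x k) s) / N - g i (x i) s)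
        ≤ 0 := by
      rw [← Finset.sum_add_distrib]
      refine Finset.sum_nonpos fun s _ => ?_
      rw [← mul_add, add_sub_cancel]
      exact mul_nonpos_of_nonneg_of_nonpos (hμ s).1
        (div_nonpos_of_nonpos_of_nonneg (hfeas s) hNpos.le)
    linarith [hqle i μ (x i) (hx i)]
  have hbdd : BddBelow (Set.range η) := ⟨q μstar, Set.forall_mem_range.2 lower⟩
  have hq_le : q μstar ≤ sInf (Set.range η) :=
    le_csInf (Set.range_nonempty η) (Set.forall_mem_range.2 lower)
  have hle_P : sInf (Set.range η) ≤ sInf P := le_csInf hPne fun c hc => by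
    obtain ⟨lam, h⟩ := upper c hc
    exact (csInf_le hbdd ⟨lam, rfl⟩).trans h
  refine ⟨hbdd, ?_, le_antisymm hle_P (strong.trans hq_le)⟩
  rw [le_antisymm (hle_P.trans strong) hq_le]
  symm
  refine IsGreatest.csSup_eq ⟨⟨fun _ => μstar, fun _ => hbox, fun _ _ _ => rfl, hq μstar⟩, ?_⟩
  rintro _ ⟨μ, hμ, hadj, rfl⟩
  have hconst : ∀ i j, μ i = μ j := by
    intro i j
    obtain ⟨p⟩ := hG.preconnected i j
    induction p with
    | nil => rfl
    | cons h _ ih => exact (hadj _ _ h).trans ih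
  obtain ⟨r⟩ := hG.nonempty
  rw [Finset.sum_congr rfl fun i _ => by rw [hconst i r], ← hq]
  exact hμstaropt _ fun s => (hμ r s).1
end

section
/- Let μ* be an optimal solution of the dual problem and let M > 0 satisfy M > ‖μ*‖_∞. Then the relaxed primal problem — minimize ∑_{i=1}^N f_i(x_i) + M·1ᵀρ over x_i ∈ X_i and ρ ⪰ 0 subject to ∑_{i=1}^N g_i(x_i) ⪯ ρ — has optimal value equal to f*, the optimal value of the original primal problem. -/
/-- Existence of a Lagrange multiplier for a convex program satisfying Slater's condition. -/
theorem exists_lagrange_multiplier_of_slater {E ι : Type*} [AddCommGroup E] [Module ℝ E]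
    [Fintype ι] {C : Set E} {F : E → ℝ} {G : E → ι → ℝ} (hF : ConvexOn ℝ C F)
    (hG : ∀ s, ConvexOn ℝ C (fun x => G x s)) (hslater : ∃ x ∈ C, ∀ s, G x s < 0) {p : ℝ}
    (hp : ∀ x ∈ C, (∀ s, G x s ≤ 0) → p ≤ F x) :
    ∃ ν : ι → ℝ, (∀ s, 0 ≤ ν s) ∧ ∀ x ∈ C, p ≤ F x + ∑ s, ν s * G x s := by
  classical
  let A : Set ((ι → ℝ) × ℝ) :=
    ⋃ x ∈ C, (Set.univ.pi fun s => Set.Ioi (G x s)) ×ˢ Set.Ioi (F x)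
  have memA : ∀ u t, (u, t) ∈ A ↔ ∃ x ∈ C, (∀ s, G x s < u s) ∧ F x < t := by
    intro u t
    simp only [A, Set.mem_iUnion, Set.mem_prod, Set.mem_univ_pi, Set.mem_Ioi, exists_prop]
  have hAo : IsOpen A := isOpen_biUnion fun x _ =>
    (isOpen_set_pi Set.finite_univ fun _ _ => isOpen_Ioi).prod isOpen_Ioi
  have hAc : Convex ℝ A := by
    rw [convex_iff_forall_pos]
    rintro ⟨u, t⟩ h₁ ⟨v, r⟩ h₂ a b ha hb hab
    obtain ⟨x, hx, hxu, hxt⟩ := (memA u t).1 h₁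
    obtain ⟨y, hy, hyv, hyr⟩ := (memA v r).1 h₂
    refine (memA _ _).2 ⟨a • x + b • y, hF.1 hx hy ha.le hb.le hab, fun s => ?_, ?_⟩
    · refine ((hG s).2 hx hy ha.le hb.le hab).trans_lt ?_
      exact add_lt_add (mul_lt_mul_of_pos_left (hxu s) ha) (mul_lt_mul_of_pos_left (hyv s) hb)
    · refine (hF.2 hx hy ha.le hb.le hab).trans_lt ?_
      exact add_lt_add (mul_lt_mul_of_pos_left hxt ha) (mul_lt_mul_of_pos_left hyr hb)
  have hpA : ((0 : ι → ℝ), p) ∉ A := by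
    rw [memA]
    rintro ⟨x, hx, hg, hf⟩
    exact absurd (hp x hx fun s => (hg s).le) (not_le.2 hf)
  obtain ⟨φ, hφ⟩ := geometric_hahn_banach_point_open hAc hAo hpA
  let l : ι → ℝ := fun s => φ (Pi.single s 1, 0)
  let τ : ℝ := φ (0, 1)
  have hφ_eq : ∀ u t, φ (u, t) = ∑ s, l s * u s + τ * t := by
    intro u t
    have h : ((u, t) : (ι → ℝ) × ℝ) =
        ∑ s, u s • ((Pi.single s 1 : ι → ℝ), (0 : ℝ)) + t • ((0 : ι → ℝ), (1 : ℝ)) := by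
      ext s
      · simp [Prod.fst_sum, Finset.sum_apply, Pi.single_apply]
      · simp [Prod.snd_sum]
    rw [h, map_add, map_sum, map_smul]
    simp only [map_smul, smul_eq_mul, l, τ]
    congr 1
    · exact Finset.sum_congr rfl fun s _ => mul_comm _ _
    · exact mul_comm _ _
  have hsep : ∀ (u : ι → ℝ) (t : ℝ), (∃ x ∈ C, (∀ s, G x s < u s) ∧ F x < t) →
      τ * p < ∑ s, l s * u s + τ * t := by
    intro u t h
    have := hφ _ ((memA u t).2 h)
    rw [hφ_eq, hφ_eq] at this
    simpa using this
  obtain ⟨z, hz, hzG⟩ := hslater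
  have hpz : p ≤ F z := hp z hz fun s => (hzG s).le
  have hτ : 0 < τ := by
    have := hsep 0 (F z + 1) ⟨z, hz, hzG, by linarith⟩
    simp only [Pi.zero_apply, mul_zero, Finset.sum_const_zero, zero_add] at this
    by_contra! h
    nlinarith
  have hl : ∀ s, 0 ≤ l s := by
    intro s
    by_contra! h
    have hK : 0 ≤ τ * (p - (F z + 1)) / l s :=
      div_nonneg_of_nonpos (by nlinarith) h.le
    have := hsep (Pi.single s (τ * (p - (F z + 1)) / l s)) (F z + 1)
      ⟨z, hz, fun r => (hzG r).trans_le ?_, by linarith⟩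
    · simp only [Pi.single_apply, mul_ite, mul_zero, Finset.sum_ite_eq', Finset.mem_univ,
        if_true, mul_div_cancel₀ _ h.ne] at this
      linarith
    · rw [Pi.single_apply]
      split_ifs <;> simp [hK]
  refine ⟨fun s => l s / τ, fun s => div_nonneg (hl s) hτ.le, fun x hx => ?_⟩
  have hmain : τ * p ≤ ∑ s, l s * G x s + τ * F x := by
    by_contra! h
    have hD : 0 < ∑ s, l s + τ := add_pos_of_nonneg_of_pos (Finset.sum_nonneg fun s _ => hl s) hτ
    set ε := (τ * p - (∑ s, l s * G x s + τ * F x)) / (∑ s, l s + τ) with hε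
    have hε0 : 0 < ε := div_pos (by linarith) hD
    have h₁ := hsep (fun s => G x s + ε) (F x + ε)
      ⟨x, hx, fun s => by linarith, by linarith⟩
    have h₂ : ε * (∑ s, l s + τ) = τ * p - (∑ s, l s * G x s + τ * F x) :=
      div_mul_cancel₀ _ hD.ne'
    simp only [mul_add, Finset.sum_add_distrib, ← Finset.sum_mul] at h₁
    linarith
  have hsum : ∑ s, l s / τ * G x s = (∑ s, l s * G x s) / τ := by
    rw [Finset.sum_div]
    exact Finset.sum_congr rfl fun s _ => by ring
  rw [hsum, ← sub_le_iff_le_add', le_div_iff₀ hτ]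
  linarith


/-- relaxed primal has the same optimal value as the primal.
Let `μ⋆` be a dual optimal solution and `M > ‖μ⋆‖_∞` (sup-norm on `Fin S → ℝ`).
Then the relaxed primal problem — minimize `∑ᵢ fᵢ(xᵢ) + M·1ᵀρ` over `xᵢ ∈ Xᵢ`,
`ρ ⪰ 0`, subject to `∑ᵢ gᵢ(xᵢ) ⪯ ρ` — has optimal value equal to `f⋆`, the
optimal value of the original primal problem. -/
theorem relaxed_primal_same_value
    (N S : ℕ) (hN : 0 < N) (hS : 0 < S)
    (n : Fin N → ℕ)
    (X : ∀ i : Fin N, Set (Fin (n i) → ℝ))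
    (f : ∀ i : Fin N, (Fin (n i) → ℝ) → ℝ)
    (g : ∀ i : Fin N, (Fin (n i) → ℝ) → Fin S → ℝ)
    (hXne : ∀ i, (X i).Nonempty)
    (hXcp : ∀ i, IsCompact (X i))
    (hXcv : ∀ i, Convex ℝ (X i))
    (hf : ∀ i, ConvexOn ℝ Set.univ (f i))
    (hg : ∀ i s, ConvexOn ℝ Set.univ (fun x => g i x s))
    (slater : ∃ xb : ∀ i : Fin N, Fin (n i) → ℝ,
      (∀ i, xb i ∈ X i) ∧ ∀ s, (∑ i, g i (xb i) s) < 0)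
    (q : (Fin S → ℝ) → ℝ)
    (hq : ∀ μ, q μ =
      ∑ i, sInf ((fun x => f i x + ∑ s, μ s * g i x s) '' X i))
    (μstar : Fin S → ℝ)
    (hμstar0 : ∀ s, 0 ≤ μstar s)
    (hμstaropt : ∀ μ : Fin S → ℝ, (∀ s, 0 ≤ μ s) → q μ ≤ q μstar)
    (M : ℝ) (hM : 0 < M) (hMμ : ‖μstar‖ < M)
    (R P : Set ℝ)
    (hR : R = {c | ∃ (x : ∀ i : Fin N, Fin (n i) → ℝ) (ρ : Fin S → ℝ),
      (∀ i, x i ∈ X i) ∧ (∀ s, 0 ≤ ρ s) ∧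
      (∀ s, (∑ i, g i (x i) s) ≤ ρ s) ∧
      c = (∑ i, f i (x i)) + M * (∑ s, ρ s)})
    (hP : P = {c | ∃ x : ∀ i : Fin N, Fin (n i) → ℝ,
      (∀ i, x i ∈ X i) ∧ (∀ s, (∑ i, g i (x i) s) ≤ 0) ∧
      c = ∑ i, f i (x i)}) :
    BddBelow R ∧ sInf R = sInf P := by
  subst hR hP
  have hcont : ∀ (ν : Fin S → ℝ) i, ContinuousOn (fun x => f i x + ∑ s, ν s * g i x s) (X i) := by
    intro ν i
    have hfc : Continuous (f i) := by
      rw [← continuousOn_univ]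
      exact (hf i).continuousOn isOpen_univ
    have hgc : ∀ s, Continuous fun x => g i x s := by
      intro s
      rw [← continuousOn_univ]
      exact (hg i s).continuousOn isOpen_univ
    exact (hfc.add (continuous_finsetSum _ fun s _ => continuous_const.mul (hgc s))).continuousOn
  have hsplit : ∀ (ν : Fin S → ℝ) (x : ∀ i : Fin N, Fin (n i) → ℝ),
      ∑ i, (f i (x i) + ∑ s, ν s * g i (x i) s) =
        ∑ i, f i (x i) + ∑ s, ν s * ∑ i, g i (x i) s := by
    intro ν x
    simp only [Finset.sum_add_distrib, Finset.mul_sum]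
    rw [Finset.sum_comm]
  have hq_le : ∀ x : ∀ i : Fin N, Fin (n i) → ℝ, (∀ i, x i ∈ X i) →
      q μstar ≤ ∑ i, f i (x i) + ∑ s, μstar s * ∑ i, g i (x i) s := by
    intro x hx
    rw [hq, ← hsplit]
    exact Finset.sum_le_sum fun i _ =>
      csInf_le ((hXcp i).bddBelow_image (hcont μstar i)) ⟨x i, hx i, rfl⟩
  have hR_le : ∀ c ∈ {c | ∃ (x : ∀ i : Fin N, Fin (n i) → ℝ) (ρ : Fin S → ℝ),
      (∀ i, x i ∈ X i) ∧ (∀ s, 0 ≤ ρ s) ∧ (∀ s, (∑ i, g i (x i) s) ≤ ρ s) ∧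
      c = (∑ i, f i (x i)) + M * (∑ s, ρ s)}, q μstar ≤ c := by
    rintro c ⟨x, ρ, hx, hρ, hgρ, rfl⟩
    refine (hq_le x hx).trans (add_le_add le_rfl ?_)
    rw [Finset.mul_sum]
    refine Finset.sum_le_sum fun s _ => (mul_le_mul_of_nonneg_left (hgρ s) (hμstar0 s)).trans ?_
    exact mul_le_mul_of_nonneg_right
      (((le_abs_self _).trans (norm_le_pi_norm μstar s)).trans hMμ.le) (hρ s)
  have hsub : {c | ∃ x : ∀ i : Fin N, Fin (n i) → ℝ,
      (∀ i, x i ∈ X i) ∧ (∀ s, (∑ i, g i (x i) s) ≤ 0) ∧ c = ∑ i, f i (x i)} ⊆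
      {c | ∃ (x : ∀ i : Fin N, Fin (n i) → ℝ) (ρ : Fin S → ℝ),
      (∀ i, x i ∈ X i) ∧ (∀ s, 0 ≤ ρ s) ∧ (∀ s, (∑ i, g i (x i) s) ≤ ρ s) ∧
      c = (∑ i, f i (x i)) + M * (∑ s, ρ s)} := by
    rintro c ⟨x, hx, hgx, rfl⟩
    exact ⟨x, 0, hx, fun _ => le_rfl, hgx, by simp⟩
  have hbdd := (⟨q μstar, hR_le⟩ : BddBelow _)
  have hPne : {c | ∃ x : ∀ i : Fin N, Fin (n i) → ℝ,
      (∀ i, x i ∈ X i) ∧ (∀ s, (∑ i, g i (x i) s) ≤ 0) ∧ c = ∑ i, f i (x i)}.Nonempty := by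
    obtain ⟨xb, hxb, hgb⟩ := slater
    exact ⟨_, xb, hxb, fun s => (hgb s).le, rfl⟩
  refine ⟨hbdd, le_antisymm (csInf_le_csInf hbdd hPne hsub) ?_⟩
  refine le_csInf (hPne.mono hsub) fun c hc => le_trans ?_ (hR_le c hc)
  have hCcv : Convex ℝ (Set.univ.pi X) := convex_pi fun i _ => hXcv i
  have hsum_cv : ∀ h : ∀ i : Fin N, (Fin (n i) → ℝ) → ℝ, (∀ i, ConvexOn ℝ Set.univ (h i)) →
      ConvexOn ℝ (Set.univ.pi X) (fun x => ∑ i, h i (x i)) := by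
    intro h hh
    refine ⟨hCcv, fun x _ y _ a b ha hb hab => ?_⟩
    simp only [smul_eq_mul, Finset.mul_sum, ← Finset.sum_add_distrib]
    exact Finset.sum_le_sum fun i _ =>
      (hh i).2 (Set.mem_univ (x i)) (Set.mem_univ (y i)) ha hb hab
  obtain ⟨ν, hν, hpν⟩ := exists_lagrange_multiplier_of_slater
    (G := fun x s => ∑ i, g i (x i) s) (hsum_cv f hf) (fun s => hsum_cv _ fun i => hg i s)
    (by
      obtain ⟨xb, hxb, hgb⟩ := slater
      exact ⟨xb, fun i _ => hxb i, hgb⟩)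
    (fun x hx hgx => csInf_le (BddBelow.mono hsub hbdd) ⟨x, fun i => hx i trivial, hgx, rfl⟩)
  refine le_trans ?_ (hμstaropt ν hν)
  choose y hy hy_eq using fun i => (hXcp i).exists_sInf_image_eq (hXne i) (hcont ν i)
  rw [hq, Finset.sum_congr rfl fun i _ => hy_eq i, hsplit]
  exact hpν y fun i _ => hy i
end

section
/- Let μ* be an optimal solution of the dual problem and M > ‖μ*‖_∞. Let γ : ℕ → ℝ satisfy γ(t) ≥ 0, γ(t) → 0, ∑_t γ(t) = ∞ and ∑_t γ(t)² < ∞. Consider sequences generated by the distributed algorithm: for each t ≥ 0 and each node i, ((x_i(t+1), ρ_i(t+1)), μ_i(t+1)) is a primal–dual optimal solution pair (Lagrangian saddle point) of the local problem minimize f_i(x_i) + M·1ᵀρ_i over x_i ∈ X_i, ρ_i ⪰ 0, subject to g_i(x_i) + ∑_{j∈N_i}( λ_ij(t) − λ_ji(t) ) ⪯ ρ_i, and the multipliers are updated as λ_ij(t+1) = λ_ij(t) − γ(t)( μ_i(t+1) − μ_j(t+1) ) for all (i,j) ∈ E, from arbitrary initial values λ_ij(0). Then the sequence of costs ∑_{i=1}^N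 ( f_i(x_i(t)) + M·1ᵀρ_i(t) ) converges to f*, the optimal value of the original primal problem. -/
open Filter Topology

/-- A sequence bounded below whose increments are bounded above by a nonnegative summable
sequence converges. -/
theorem exists_tendsto_of_le_add_summable {u e : ℕ → ℝ} (hu : ∀ t, 0 ≤ u t)
    (he : ∀ t, 0 ≤ e t) (hsum : Summable e) (hstep : ∀ t, u (t + 1) ≤ u t + e t) :
    ∃ L, Tendsto u atTop (𝓝 L) := by
  have hanti : Antitone fun t => u t - ∑ k ∈ Finset.range t, e k := by
    refine antitone_nat_of_succ_le fun t => ?_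
    rw [Finset.sum_range_succ]
    linarith [hstep t]
  have hbdd : BddBelow (Set.range fun t => u t - ∑ k ∈ Finset.range t, e k) := by
    refine ⟨-∑' k, e k, ?_⟩
    rintro _ ⟨t, rfl⟩
    have := hsum.sum_le_tsum (Finset.range t) fun k _ => he k
    change _ ≤ u t - _
    linarith [hu t]
  refine ⟨_, ((tendsto_atTop_ciInf hanti hbdd).add hsum.hasSum.tendsto_sum_nat).congr fun t => ?_⟩
  simp

/-- The scalar recursion behind the subgradient method with square-summable, non-summable steps:
the optimality gap tends to zero. -/
theorem tendsto_zero_of_subgradient_recursion {a v γ : ℕ → ℝ} {C : ℝ} (hC : 0 ≤ C)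
    (ha : ∀ t, 0 ≤ a t) (hv : ∀ t, 0 ≤ v t) (hγ : ∀ t, 0 ≤ γ t)
    (hdiv : Tendsto (fun T => ∑ t ∈ Finset.range T, γ t) atTop atTop)
    (hsq : Summable fun t => γ t ^ 2)
    (hdescent : ∀ t, v (t + 1) ≤ v t - 2 * γ t * a t + γ t ^ 2 * C)
    (hstep : ∀ t, a (t + 1) ≤ a t + γ t * C) :
    Tendsto a atTop (𝓝 0) := by
  have hγa : Summable fun t => γ t * a t := by
    refine summable_of_sum_range_le (c := (v 0 + (∑' t, γ t ^ 2) * C) / 2)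
      (fun t => mul_nonneg (hγ t) (ha t)) fun T => ?_
    have hind : v T + 2 * ∑ t ∈ Finset.range T, γ t * a t
        ≤ v 0 + (∑ t ∈ Finset.range T, γ t ^ 2) * C := by
      induction T with
      | zero => simp
      | succ T ih =>
        rw [Finset.sum_range_succ, Finset.sum_range_succ]
        linarith [hdescent T]
    have := mul_le_mul_of_nonneg_right
      (hsq.sum_le_tsum (Finset.range T) fun k _ => sq_nonneg (γ k)) hC
    linarith [hv T]
  obtain ⟨L, hL⟩ : ∃ L, Tendsto (fun t => a t ^ 2) atTop (𝓝 L) := by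
    refine exists_tendsto_of_le_add_summable (e := fun t => 2 * C * (γ t * a t) + C ^ 2 * γ t ^ 2)
      (fun t => sq_nonneg _) (fun t => ?_) ((hγa.mul_left _).add (hsq.mul_left _)) fun t => ?_
    · have := mul_nonneg hC (mul_nonneg (hγ t) (ha t))
      have := sq_nonneg (C * γ t)
      change 0 ≤ 2 * C * (γ t * a t) + C ^ 2 * γ t ^ 2
      nlinarith
    · calc a (t + 1) ^ 2 ≤ (a t + γ t * C) ^ 2 := pow_le_pow_left₀ (ha _) (hstep t) 2
        _ = _ := by ring
  have hlim : Tendsto a atTop (𝓝 √L) :=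
    (hL.sqrt).congr fun t => Real.sqrt_sq (ha t)
  rcases (Real.sqrt_nonneg L).eq_or_lt with h0 | hpos
  · rwa [← h0] at hlim
  · exfalso
    obtain ⟨T₀, hT₀⟩ := eventually_atTop.1 (hlim.eventually (lt_mem_nhds (half_lt_self hpos)))
    have hγs : Summable γ := by
      rw [← summable_nat_add_iff T₀] at hγa ⊢
      refine (hγa.mul_left (√L / 2)⁻¹).of_nonneg_of_le (fun t => hγ _) fun t => ?_
      rw [inv_mul_eq_div, le_div_iff₀ (half_pos hpos)]
      exact mul_le_mul_of_nonneg_left (hT₀ _ (Nat.le_add_left _ _)).le (hγ _)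
    exact not_tendsto_nhds_of_tendsto_atTop hdiv _ hγs.hasSum.tendsto_sum_nat

/-- Existence of Lagrange multipliers for a convex program under Slater's condition. -/
theorem exists_multiplier_of_slater {E σ : Type*} [AddCommGroup E] [Module ℝ E] [Fintype σ]
    {K : Set E} {F : E → ℝ} {H : E → σ → ℝ} (hF : ConvexOn ℝ K F)
    (hH : ∀ s, ConvexOn ℝ K fun y => H y s) {yb : E} (hyb : yb ∈ K) (hslater : ∀ s, H yb s < 0)
    {c : ℝ} (hc : ∀ y ∈ K, (∀ s, H y s ≤ 0) → c ≤ F y) :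
    ∃ μ : σ → ℝ, (∀ s, 0 ≤ μ s) ∧ ∀ y ∈ K, c ≤ F y + ∑ s, μ s * H y s := by
  classical
  let A : Set ((σ → ℝ) × ℝ) := {p | ∃ y ∈ K, (∀ s, H y s < p.1 s) ∧ F y < p.2}
  have hAconv : Convex ℝ A := by
    rintro p ⟨y, hy, hyp, hyp'⟩ p' ⟨z, hz, hzp, hzp'⟩ a b ha hb hab
    refine ⟨a • y + b • z, hF.1 hy hz ha hb hab, fun s => ?_, ?_⟩
    · refine ((hH s).2 hy hz ha hb hab).trans_lt ?_
      simp only [Prod.fst_add, Prod.smul_fst, Pi.add_apply, Pi.smul_apply, smul_eq_mul]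
      rcases ha.eq_or_lt with rfl | ha
      · obtain rfl : b = 1 := by linarith
        simpa using hzp s
      · nlinarith [mul_lt_mul_of_pos_left (hyp s) ha, mul_le_mul_of_nonneg_left (hzp s).le hb]
    · refine (hF.2 hy hz ha hb hab).trans_lt ?_
      simp only [Prod.snd_add, Prod.smul_snd, smul_eq_mul]
      rcases ha.eq_or_lt with rfl | ha
      · obtain rfl : b = 1 := by linarith
        simpa using hzp'
      · nlinarith [mul_lt_mul_of_pos_left hyp' ha, mul_le_mul_of_nonneg_left hzp'.le hb]
  have hAopen : IsOpen A := by
    have : A = ⋃ y ∈ K, {p : (σ → ℝ) × ℝ | (∀ s, H y s < p.1 s) ∧ F y < p.2} := by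
      ext p
      simp only [A, Set.mem_iUnion, exists_prop]
      rfl
    rw [this]
    refine isOpen_biUnion fun y _ => ?_
    have hy : IsOpen {p : (σ → ℝ) × ℝ | ∀ s, H y s < p.1 s} := by
      rw [Set.ofPred_forall]
      exact isOpen_iInter_of_finite fun s => isOpen_lt continuous_const (by fun_prop)
    exact hy.inter (isOpen_lt continuous_const continuous_snd)
  have hnot : ((0 : σ → ℝ), c) ∉ A := by
    rintro ⟨y, hy, hys, hyc⟩
    exact (hc y hy fun s => (hys s).le).not_gt hyc
  obtain ⟨φ, hφ⟩ := geometric_hahn_banach_point_open hAconv hAopen hnot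
  let α : σ → ℝ := fun s => φ (Pi.single s 1, 0)
  let β : ℝ := φ (0, 1)
  have hφeq (u : σ → ℝ) (r : ℝ) : φ (u, r) = ∑ s, u s * α s + r * β := by
    have hu : (u, r) = ∑ s, u s • ((Pi.single s 1 : σ → ℝ), (0 : ℝ)) + r • ((0 : σ → ℝ), (1 : ℝ)) := by
      ext s
      · simp [Prod.fst_sum, Finset.sum_apply, Pi.single_apply]
      · simp [Prod.snd_sum]
    rw [hu, map_add, map_sum, map_smul]
    simp only [map_smul, smul_eq_mul, α, β]
  have hsep (y : E) (hy : y ∈ K) (u : σ → ℝ) (hu : ∀ s, H y s < u s) (r : ℝ) (hr : F y < r) :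
      c * β < ∑ s, u s * α s + r * β := by
    have := hφ (u, r) ⟨y, hy, hu, hr⟩
    rw [hφeq, hφeq] at this
    simpa using this
  have hβ : 0 < β := by
    have h := hsep yb hyb 0 (by simpa using hslater) (max (F yb) c + 1)
      (by linarith [le_max_left (F yb) c])
    simp only [Pi.zero_apply, zero_mul, Finset.sum_const_zero, zero_add] at h
    by_contra! hβ
    nlinarith [le_max_right (F yb) c]
  have hα (s : σ) : 0 ≤ α s := by
    by_contra! hs
    have h (k : ℝ) (hk : 0 ≤ k) : c * β < k * α s + (F yb + 1) * β := by
      have := hsep yb hyb (Pi.single s k) (fun s' => (hslater s').trans_le ?_) (F yb + 1)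
        (by linarith)
      · simpa [Pi.single_apply] using this
      · exact (Pi.single_nonneg (i := s).2 hk : (0 : σ → ℝ) ≤ _) s'
    have hk := h (max 0 ((F yb + 1 - c) * β / (-α s))) (le_max_left _ _)
    have := mul_le_mul_of_nonneg_right (le_max_right 0 ((F yb + 1 - c) * β / (-α s)))
      (neg_pos.2 hs).le
    rw [div_mul_cancel₀ _ (neg_pos.2 hs).ne'] at this
    linarith
  refine ⟨fun s => α s / β, fun s => div_nonneg (hα s) hβ.le, fun y hy => ?_⟩
  have hlim : c * β ≤ ∑ s, H y s * α s + F y * β := by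
    refine le_of_forall_pos_lt_add fun ε hε => ?_
    set D := ∑ s, α s + β with hD
    have hDpos : 0 < D := add_pos_of_nonneg_of_pos (Finset.sum_nonneg fun s _ => hα s) hβ
    have hδ : 0 < ε / D := div_pos hε hDpos
    have h := hsep y hy (fun s => H y s + ε / D) (fun s => by linarith) (F y + ε / D) (by linarith)
    simp only [add_mul, Finset.sum_add_distrib, ← Finset.mul_sum] at h
    have : ε / D * ∑ s, α s + ε / D * β = ε := by
      rw [← mul_add, ← hD, div_mul_cancel₀ _ hDpos.ne']
    linarith
  have hsum : ∑ s, α s / β * H y s = (∑ s, H y s * α s) / β := by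
    rw [Finset.sum_div]
    exact Finset.sum_congr rfl fun s _ => by ring
  rw [hsum, ← sub_le_iff_le_add', le_div_iff₀ hβ]
  linarith

/-- A separable convex program with compact local constraint sets and a Slater point has an
optimal solution, and every dual optimal solution attains the primal optimal value. -/
theorem exists_primal_optimum_strong_duality {ι σ : Type*} [Fintype ι] [Fintype σ]
    {E : ι → Type*} [∀ i, AddCommGroup (E i)] [∀ i, Module ℝ (E i)] [∀ i, TopologicalSpace (E i)]
    [∀ i, T2Space (E i)] {X : ∀ i, Set (E i)} {f : ∀ i, E i → ℝ} {g : ∀ i, E i → σ → ℝ}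
    (hXne : ∀ i, (X i).Nonempty) (hXcp : ∀ i, IsCompact (X i)) (hXcv : ∀ i, Convex ℝ (X i))
    (hf : ∀ i, ConvexOn ℝ Set.univ (f i)) (hfc : ∀ i, ContinuousOn (f i) (X i))
    (hg : ∀ i s, ConvexOn ℝ Set.univ (fun x => g i x s))
    (hgc : ∀ i s, ContinuousOn (fun x => g i x s) (X i))
    (slater : ∃ xb : ∀ i, E i, (∀ i, xb i ∈ X i) ∧ ∀ s, ∑ i, g i (xb i) s < 0)
    {q : (σ → ℝ) → ℝ}
    (hq : ∀ μ, q μ = ∑ i, sInf ((fun x => f i x + ∑ s, μ s * g i x s) '' X i))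
    {μs : σ → ℝ} (hμs : ∀ μ : σ → ℝ, (∀ s, 0 ≤ μ s) → q μ ≤ q μs) :
    ∃ xs : ∀ i, E i, (∀ i, xs i ∈ X i) ∧ (∀ s, ∑ i, g i (xs i) s ≤ 0) ∧
      sInf {c | ∃ y : ∀ i, E i, (∀ i, y i ∈ X i) ∧ (∀ s, ∑ i, g i (y i) s ≤ 0) ∧
        c = ∑ i, f i (y i)} = ∑ i, f i (xs i) ∧
      ∀ y : ∀ i, E i, (∀ i, y i ∈ X i) →
        ∑ i, f i (xs i) ≤ ∑ i, f i (y i) + ∑ s, μs s * ∑ i, g i (y i) s := by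
  set K : Set (∀ i : ι, E i) := Set.univ.pi X with hK
  have hKcp : IsCompact K := isCompact_univ_pi hXcp
  have hKcv : Convex ℝ K := convex_pi fun i _ => hXcv i
  have hmemK {y : ∀ i : ι, E i} : y ∈ K ↔ ∀ i, y i ∈ X i := by simp [hK]
  have hproj (i : ι) : Set.MapsTo (fun y : ∀ i : ι, E i => y i) K (X i) :=
    fun y hy => hmemK.1 hy i
  have hconv {φ : ∀ i : ι, E i → ℝ} (hφ : ∀ i, ConvexOn ℝ Set.univ (φ i)) :
      ConvexOn ℝ K fun y => ∑ i, φ i (y i) := by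
    refine ⟨hKcv, fun y _ z _ a b ha hb hab => ?_⟩
    simp only [smul_eq_mul, Finset.mul_sum, ← Finset.sum_add_distrib]
    exact Finset.sum_le_sum fun i _ => (hφ i).2 trivial trivial ha hb hab
  have hFcont : ContinuousOn (fun y : ∀ i : ι, E i => ∑ i, f i (y i)) K :=
    continuousOn_finsetSum _ fun i _ =>
      (hfc i).comp (continuous_apply i).continuousOn (hproj i)
  have hGcont (s : σ) :
      ContinuousOn (fun y : ∀ i : ι, E i => ∑ i, g i (y i) s) K :=
    continuousOn_finsetSum _ fun i _ =>
      (hgc i s).comp (continuous_apply i).continuousOn (hproj i)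
  obtain ⟨xb, hxb, hxb'⟩ := slater
  obtain ⟨xs, ⟨hxsK, hxsg⟩, hxsmin⟩ : ∃ y ∈ K ∩ {y | ∀ s, ∑ i, g i (y i) s ≤ 0},
      ∀ z ∈ K, (∀ s, ∑ i, g i (z i) s ≤ 0) → ∑ i, f i (y i) ≤ ∑ i, f i (z i) := by
    have hcp : IsCompact (K ∩ {y | ∀ s, ∑ i, g i (y i) s ≤ 0}) := by
      have : K ∩ {y | ∀ s, ∑ i, g i (y i) s ≤ 0}
          = K ∩ ⋂ s, K ∩ (fun y => ∑ i, g i (y i) s) ⁻¹' Set.Iic 0 := by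
        ext y
        simp only [Set.mem_inter_iff, Set.mem_iInter, Set.mem_preimage, Set.mem_Iic]
        exact ⟨fun h => ⟨h.1, fun s => ⟨h.1, h.2 s⟩⟩, fun h => ⟨h.1, fun s => (h.2 s).2⟩⟩
      rw [this]
      exact hKcp.inter_right (isClosed_iInter fun s =>
        (hGcont s).preimage_isClosed_of_isClosed hKcp.isClosed isClosed_Iic)
    obtain ⟨y, hy, hmin⟩ := hcp.exists_isMinOn ⟨xb, hmemK.2 hxb, fun s => (hxb' s).le⟩
      (hFcont.mono Set.inter_subset_left)
    exact ⟨y, hy, fun z hz hz' => hmin ⟨hz, hz'⟩⟩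
  have hopt : sInf {c | ∃ y : ∀ i : ι, E i, (∀ i, y i ∈ X i) ∧
      (∀ s, (∑ i, g i (y i) s) ≤ 0) ∧ c = ∑ i, f i (y i)} = ∑ i, f i (xs i) := by
    refine IsLeast.csInf_eq ⟨⟨xs, hmemK.1 hxsK, hxsg, rfl⟩, ?_⟩
    rintro _ ⟨y, hy, hyg, rfl⟩
    exact hxsmin y (hmemK.2 hy) hyg
  refine ⟨xs, hmemK.1 hxsK, hxsg, hopt, fun y hy => ?_⟩
  have hlagcont (ν : σ → ℝ) (i : ι) :
      ContinuousOn (fun y => f i y + ∑ s, ν s * g i y s) (X i) :=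
    (hfc i).add (continuousOn_finsetSum _ fun s _ => continuousOn_const.mul (hgc i s))
  have hlagsum (ν : σ → ℝ) (y : ∀ i : ι, E i) :
      ∑ i, (f i (y i) + ∑ s, ν s * g i (y i) s)
        = ∑ i, f i (y i) + ∑ s, ν s * ∑ i, g i (y i) s := by
    rw [Finset.sum_add_distrib, Finset.sum_comm]
    simp only [Finset.mul_sum]
  obtain ⟨ν, hν, hνle⟩ := exists_multiplier_of_slater (hconv hf) (fun s => hconv fun i => hg i s)
    (hmemK.2 hxb) hxb' hxsmin
  have hfsq : ∑ i, f i (xs i) ≤ q ν := by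
    choose z hz hzmin using fun i =>
      (hXcp i).exists_sInf_image_eq (hXne i) (hlagcont ν i)
    rw [hq, Finset.sum_congr rfl fun i _ => hzmin i, hlagsum]
    exact hνle z (hmemK.2 hz)
  refine hfsq.trans ((hμs ν hν).trans ?_)
  rw [hq, ← hlagsum]
  exact Finset.sum_le_sum fun i _ => csInf_le
    ((hXcp i).image_of_continuousOn (hlagcont μs i)).bddBelow ⟨y i, hy i, rfl⟩

namespace SimpleGraph

variable {V : Type*} [Fintype V] (G : SimpleGraph V) [DecidableRel G.Adj]

/-- Summation by parts: the graph divergence is adjoint to the graph gradient. -/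
theorem sum_mul_divergence (a : V → ℝ) (D : V → V → ℝ) :
    ∑ i, a i * ∑ j ∈ Finset.univ.filter (fun j => G.Adj i j), (D i j - D j i)
      = ∑ i, ∑ j ∈ Finset.univ.filter (fun j => G.Adj i j), D i j * (a i - a j) := by
  have hcomm : ∑ i, ∑ j ∈ Finset.univ.filter (fun j => G.Adj i j), a i * D j i
      = ∑ i, ∑ j ∈ Finset.univ.filter (fun j => G.Adj i j), a j * D i j := by
    simp only [Finset.sum_filter]
    rw [Finset.sum_comm]
    simp only [G.adj_comm]
  simp only [Finset.mul_sum, mul_sub, Finset.sum_sub_distrib] at hcomm ⊢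
  rw [hcomm]
  simp only [mul_comm]

/-- The divergence of a flow on a graph sums to zero. -/
theorem sum_divergence (D : V → V → ℝ) :
    ∑ i, ∑ j ∈ Finset.univ.filter (fun j => G.Adj i j), (D i j - D j i) = 0 := by
  simpa using G.sum_mul_divergence (fun _ => 1) D

variable {G}

theorem Walk.exists_divergence_eq [DecidableEq V] {u v : V} (p : G.Walk u v) :
    ∃ D : V → V → ℝ, ∀ k, ∑ j ∈ Finset.univ.filter (fun j => G.Adj k j), (D k j - D j k)
      = (if k = u then 1 else 0) - (if k = v then 1 else 0) := by
  induction p with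
  | nil => exact ⟨0, by simp⟩
  | @cons u v w h p ih =>
    obtain ⟨D, hD⟩ := ih
    refine ⟨fun i j => D i j + if i = u ∧ j = v then 1 else 0, fun k => ?_⟩
    have hedge : ∑ j ∈ Finset.univ.filter (fun j => G.Adj k j),
        (((if k = u ∧ j = v then 1 else 0) - (if j = u ∧ k = v then 1 else 0) : ℝ))
        = (if k = u then 1 else 0) - (if k = v then 1 else 0) := by
      rw [Finset.sum_sub_distrib]
      congr 1
      · by_cases hk : k = u
        · subst hk; simp [h]
        · simp [hk]
      · by_cases hk : k = v
        · subst hk; simp [h.symm]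
        · simp [hk]
    simp only [add_sub_add_comm, Finset.sum_add_distrib, hD, hedge]
    ring

/-- On a connected graph every vector with zero sum is the divergence of a flow. -/
theorem Connected.exists_divergence_eq (hG : G.Connected) {w : V → ℝ} (hw : ∑ i, w i = 0) :
    ∃ D : V → V → ℝ, ∀ i, ∑ j ∈ Finset.univ.filter (fun j => G.Adj i j), (D i j - D j i) = w i := by
  classical
  obtain ⟨o⟩ := hG.nonempty
  have hflow (v : V) := (hG.preconnected v o).some.exists_divergence_eq
  choose D hD using hflow
  refine ⟨fun i j => ∑ v, w v * D v i j, fun i => ?_⟩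
  simp only [← Finset.sum_sub_distrib, ← mul_sub]
  rw [Finset.sum_comm]
  simp only [← Finset.mul_sum, hD]
  simp [mul_sub, Finset.sum_sub_distrib, hw]

end SimpleGraph

/-- Feasibility and complementary slackness from maximality of the multiplier in a Lagrangian. -/
theorem nonpos_and_sum_mul_eq_zero_of_isMax {σ : Type*} [Fintype σ] {c : ℝ} {μ h : σ → ℝ}
    (hμ : ∀ s, 0 ≤ μ s)
    (hmax : ∀ ν : σ → ℝ, (∀ s, 0 ≤ ν s) → c + ∑ s, ν s * h s ≤ c + ∑ s, μ s * h s) :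
    (∀ s, h s ≤ 0) ∧ ∑ s, μ s * h s = 0 := by
  classical
  refine ⟨fun s => ?_, le_antisymm ?_ ?_⟩
  · have := hmax (μ + Pi.single s 1) fun s' =>
      add_nonneg (hμ s') ((Pi.single_nonneg (i := s).2 zero_le_one : (0 : σ → ℝ) ≤ _) s')
    simpa [add_mul, Finset.sum_add_distrib, Pi.single_apply] using this
  · have := hmax (fun s => 2 * μ s) fun s => mul_nonneg zero_le_two (hμ s)
    simp only [mul_assoc, ← Finset.mul_sum] at this
    linarith
  · simpa using hmax 0 fun s => le_rfl


/-- Theorem 1, convergence of the distributed algorithm.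
Let `μ⋆` be a dual optimal solution, `M > ‖μ⋆‖_∞` (sup-norm), and let the
step-size `γ` be nonnegative, vanishing, non-summable with square-summable
squares. Suppose at every iteration `t` every node `i` computes
`((xᵢ(t+1), ρᵢ(t+1)), μᵢ(t+1))` as a primal–dual optimal solution pair
(Lagrangian saddle point) of the local relaxed problem with data
`dᵢ(t) = ∑_{j∈Nᵢ}(λ_{ij}(t) − λ_{ji}(t))`, and updates
`λ_{ij}(t+1) = λ_{ij}(t) − γ(t)(μᵢ(t+1) − μⱼ(t+1))` on every edge, from
arbitrary initial multipliers. Then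
`∑ᵢ ( fᵢ(xᵢ(t)) + M·1ᵀρᵢ(t) ) → f⋆`, the optimal value of the original
primal problem. -/
theorem distributed_algorithm_convergence
    (N S : ℕ) (hN : 0 < N) (hS : 0 < S)
    (n : Fin N → ℕ)
    (X : ∀ i : Fin N, Set (Fin (n i) → ℝ))
    (f : ∀ i : Fin N, (Fin (n i) → ℝ) → ℝ)
    (g : ∀ i : Fin N, (Fin (n i) → ℝ) → Fin S → ℝ)
    (hXne : ∀ i, (X i).Nonempty)
    (hXcp : ∀ i, IsCompact (X i))
    (hXcv : ∀ i, Convex ℝ (X i))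
    (hf : ∀ i, ConvexOn ℝ Set.univ (f i))
    (hfc : ∀ i, ContinuousOn (f i) (X i))
    (hg : ∀ i s, ConvexOn ℝ Set.univ (fun x => g i x s))
    (hgc : ∀ i s, ContinuousOn (fun x => g i x s) (X i))
    (slater : ∃ xb : ∀ i : Fin N, Fin (n i) → ℝ,
      (∀ i, xb i ∈ X i) ∧ ∀ s, (∑ i, g i (xb i) s) < 0)
    (q : (Fin S → ℝ) → ℝ)
    (hq : ∀ μ, q μ =
      ∑ i, sInf ((fun x => f i x + ∑ s, μ s * g i x s) '' X i))
    (μdualstar : Fin S → ℝ)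
    (hμdual0 : ∀ s, 0 ≤ μdualstar s)
    (hμdualopt : ∀ μ : Fin S → ℝ, (∀ s, 0 ≤ μ s) → q μ ≤ q μdualstar)
    (M : ℝ) (hM : 0 < M) (hMμ : ‖μdualstar‖ < M)
    (G : SimpleGraph (Fin N)) [DecidableRel G.Adj] (hG : G.Connected)
    -- step-size assumptions
    (γ : ℕ → ℝ) (hγ0 : ∀ t, 0 ≤ γ t)
    (hγto0 : Filter.Tendsto γ Filter.atTop (nhds 0))
    (hγdiv : Filter.Tendsto (fun T => ∑ t ∈ Finset.range T, γ t)
      Filter.atTop Filter.atTop)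
    (hγsq : Summable (fun t => (γ t) ^ 2))
    -- sequences generated by the distributed algorithm
    (x : ℕ → ∀ i : Fin N, Fin (n i) → ℝ)
    (ρ : ℕ → Fin N → Fin S → ℝ)
    (μ : ℕ → Fin N → Fin S → ℝ)
    (lam : ℕ → Fin N → Fin N → Fin S → ℝ)
    -- ((xᵢ(t+1), ρᵢ(t+1)), μᵢ(t+1)) is a Lagrangian saddle point of the local problem
    (hsaddle : ∀ t : ℕ, ∀ i : Fin N,
      x (t + 1) i ∈ X i ∧ (∀ s, 0 ≤ ρ (t + 1) i s) ∧ (∀ s, 0 ≤ μ (t + 1) i s) ∧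
      (∀ ν : Fin S → ℝ, (∀ s, 0 ≤ ν s) →
        f i (x (t + 1) i) + M * (∑ s, ρ (t + 1) i s)
          + ∑ s, ν s * (g i (x (t + 1) i) s
              + (∑ j ∈ Finset.univ.filter (fun j => G.Adj i j),
                  (lam t i j s - lam t j i s))
              - ρ (t + 1) i s)
          ≤ f i (x (t + 1) i) + M * (∑ s, ρ (t + 1) i s)
            + ∑ s, μ (t + 1) i s * (g i (x (t + 1) i) s
                + (∑ j ∈ Finset.univ.filter (fun j => G.Adj i j),
                    (lam t i j s - lam t j i s))
                - ρ (t + 1) i s)) ∧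
      (∀ xi ∈ X i, ∀ ρi : Fin S → ℝ, (∀ s, 0 ≤ ρi s) →
        f i (x (t + 1) i) + M * (∑ s, ρ (t + 1) i s)
          + ∑ s, μ (t + 1) i s * (g i (x (t + 1) i) s
              + (∑ j ∈ Finset.univ.filter (fun j => G.Adj i j),
                  (lam t i j s - lam t j i s))
              - ρ (t + 1) i s)
          ≤ f i xi + M * (∑ s, ρi s)
            + ∑ s, μ (t + 1) i s * (g i xi s
                + (∑ j ∈ Finset.univ.filter (fun j => G.Adj i j),
                    (lam t i j s - lam t j i s))
                - ρi s)))
    -- multiplier update on every edge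
    (hupdate : ∀ t : ℕ, ∀ i j : Fin N, G.Adj i j → ∀ s,
      lam (t + 1) i j s = lam t i j s - γ t * (μ (t + 1) i s - μ (t + 1) j s)) :
    Filter.Tendsto
      (fun t => ∑ i, (f i (x t i) + M * (∑ s, ρ t i s)))
      Filter.atTop
      (nhds (sInf {c | ∃ y : ∀ i : Fin N, Fin (n i) → ℝ,
        (∀ i, y i ∈ X i) ∧ (∀ s, (∑ i, g i (y i) s) ≤ 0) ∧
        c = ∑ i, f i (y i)})) := by
  obtain ⟨xs, hxsX, hxsg, hopt, hduality⟩ := exists_primal_optimum_strong_duality hXne hXcp hXcv hf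
    hfc hg hgc slater hq hμdualopt
  rw [hopt]
  set fs : ℝ := ∑ i, f i (xs i) with hfs
  -- consequences of the local saddle-point conditions
  have hx (t : ℕ) (i : Fin N) : x (t + 1) i ∈ X i := (hsaddle t i).1
  have hρ (t : ℕ) (i : Fin N) : ∀ s, 0 ≤ ρ (t + 1) i s := (hsaddle t i).2.1
  have hμ0 (t : ℕ) (i : Fin N) : ∀ s, 0 ≤ μ (t + 1) i s := (hsaddle t i).2.2.1
  have hcs (t : ℕ) (i : Fin N) := nonpos_and_sum_mul_eq_zero_of_isMax (hμ0 t i)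
    (hsaddle t i).2.2.2.1
  have hμM (t : ℕ) (i : Fin N) (s : Fin S) : μ (t + 1) i s ≤ M := by
    have h := (hsaddle t i).2.2.2.2 _ (hx t i) (ρ (t + 1) i + Pi.single s 1) fun s' =>
      add_nonneg (hρ t i s') ((Pi.single_nonneg (i := s).2 zero_le_one : (0 : Fin S → ℝ) ≤ _) s')
    simp only [Pi.add_apply, ← sub_sub, Finset.sum_add_distrib, mul_add,
      Finset.sum_sub_distrib, mul_sub] at h
    simp only [Pi.single_apply, Finset.sum_ite_eq', Finset.mem_univ, if_true, mul_ite, mul_one,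
      mul_zero] at h
    linarith
  have hμdiff (t : ℕ) (i j : Fin N) (s : Fin S) : |μ (t + 1) i s - μ (t + 1) j s| ≤ M := by
    rw [abs_le]
    constructor <;> linarith [hμ0 t i s, hμ0 t j s, hμM t i s, hμM t j s]
  set cost : ℕ → ℝ := fun t => ∑ i, (f i (x t i) + M * ∑ s, ρ t i s) with hcost
  have hsubgrad (t : ℕ) (L : Fin N → Fin N → Fin S → ℝ) (y : ∀ i : Fin N, Fin (n i) → ℝ)
      (hy : ∀ i, y i ∈ X i) (r : Fin N → Fin S → ℝ) (hr : ∀ i s, 0 ≤ r i s)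
      (hfeas : ∀ i s, g i (y i) s
        + ∑ j ∈ Finset.univ.filter (fun j => G.Adj i j), (L i j s - L j i s) ≤ r i s) :
      cost (t + 1) ≤ ∑ i, (f i (y i) + M * ∑ s, r i s)
        + ∑ s, ∑ i, ∑ j ∈ Finset.univ.filter (fun j => G.Adj i j),
          (lam t i j s - L i j s) * (μ (t + 1) i s - μ (t + 1) j s) := by
    simp only [← G.sum_mul_divergence]
    rw [Finset.sum_comm, ← Finset.sum_add_distrib]
    refine Finset.sum_le_sum fun i _ => ?_
    have h := (hsaddle t i).2.2.2.2 _ (hy i) (r i) (hr i)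
    rw [(hcs t i).2, add_zero] at h
    refine h.trans (add_le_add le_rfl (Finset.sum_le_sum fun s _ =>
      mul_le_mul_of_nonneg_left ?_ (hμ0 t i s)))
    have := hfeas i s
    simp only [Finset.sum_sub_distrib] at this ⊢
    linarith
  have hlower (t : ℕ) : fs ≤ cost (t + 1) := by
    refine (hduality _ (hx t)).trans ?_
    have hsum (s : Fin S) : ∑ i, g i (x (t + 1) i) s ≤ ∑ i, ρ (t + 1) i s := by
      have h := Finset.sum_le_sum fun i (_ : i ∈ Finset.univ) => (hcs t i).1 s
      rw [Finset.sum_sub_distrib, Finset.sum_add_distrib,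
        G.sum_divergence fun i j => lam t i j s] at h
      simp only [Finset.sum_const_zero] at h
      linarith
    simp only [hcost, Finset.sum_add_distrib, ← Finset.mul_sum]
    rw [Finset.sum_comm, Finset.mul_sum]
    refine add_le_add le_rfl (Finset.sum_le_sum fun s _ => ?_)
    refine (mul_le_mul_of_nonneg_left (hsum s) (hμdual0 s)).trans
      (mul_le_mul_of_nonneg_right ?_ (Finset.sum_nonneg fun i _ => hρ t i s))
    exact ((le_abs_self _).trans (norm_le_pi_norm μdualstar s)).trans hMμ.le
  -- an optimal flow
  obtain ⟨L, hL⟩ : ∃ L : Fin N → Fin N → Fin S → ℝ, ∀ i s,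
      g i (xs i) s + ∑ j ∈ Finset.univ.filter (fun j => G.Adj i j), (L i j s - L j i s) ≤ 0 := by
    have hN' : (N : ℝ) ≠ 0 := Nat.cast_ne_zero.2 hN.ne'
    choose D hD using fun s => hG.exists_divergence_eq
      (w := fun i => (∑ k, g k (xs k) s) / N - g i (xs i) s)
      (by simp [Finset.sum_sub_distrib, mul_div_cancel₀ _ hN'])
    refine ⟨fun i j s => D s i j, fun i s => ?_⟩
    rw [hD, add_sub_cancel]
    exact div_nonpos_of_nonpos_of_nonneg (hxsg s) N.cast_nonneg
  have hlim : Tendsto (fun t => cost (t + 1) - fs) atTop (𝓝 0) := by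
    refine tendsto_zero_of_subgradient_recursion
      (v := fun t => ∑ s, ∑ i, ∑ j ∈ Finset.univ.filter (fun j => G.Adj i j),
        (lam t i j s - L i j s) ^ 2)
      (C := ∑ _s : Fin S, ∑ i, ∑ j ∈ Finset.univ.filter (fun j => G.Adj i j), M ^ 2)
      (Finset.sum_nonneg fun _ _ => Finset.sum_nonneg fun _ _ =>
        Finset.sum_nonneg fun _ _ => sq_nonneg _)
      (fun t => sub_nonneg.2 (hlower t)) (fun t => Finset.sum_nonneg fun _ _ => Finset.sum_nonneg fun _ _ =>
        Finset.sum_nonneg fun _ _ => sq_nonneg _)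
      hγ0 hγdiv hγsq (fun t => ?_) (fun t => ?_)
    · have h := hsubgrad t L xs hxsX 0 (fun _ _ => le_rfl) hL
      simp only [Pi.zero_apply, Finset.sum_const_zero, mul_zero, add_zero, ← hfs] at h
      have hle : ∑ s, ∑ i, ∑ j ∈ Finset.univ.filter (fun j => G.Adj i j),
          (lam (t + 1) i j s - L i j s) ^ 2
          ≤ ∑ s, ∑ i, ∑ j ∈ Finset.univ.filter (fun j => G.Adj i j),
            ((lam t i j s - L i j s) ^ 2
              - 2 * γ t * ((lam t i j s - L i j s) * (μ (t + 1) i s - μ (t + 1) j s))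
              + γ t ^ 2 * M ^ 2) := by
        refine Finset.sum_le_sum fun s _ => Finset.sum_le_sum fun i _ =>
          Finset.sum_le_sum fun j hj => ?_
        rw [hupdate t i j (Finset.mem_filter.1 hj).2 s]
        have := mul_le_mul_of_nonneg_left (sq_le_sq' (neg_le_of_abs_le (hμdiff t i j s))
          (le_of_abs_le (hμdiff t i j s))) (sq_nonneg (γ t))
        linarith
      simp only [Finset.sum_add_distrib, Finset.sum_sub_distrib, ← Finset.mul_sum] at hle
      have := mul_le_mul_of_nonneg_left h (mul_nonneg zero_le_two (hγ0 t))
      linarith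
    · have h := hsubgrad (t + 1) (lam t) (x (t + 1)) (hx t) (ρ (t + 1)) (hρ t)
        fun i s => sub_nonpos.1 ((hcs t i).1 s)
      have hle : ∑ s, ∑ i, ∑ j ∈ Finset.univ.filter (fun j => G.Adj i j),
          (lam (t + 1) i j s - lam t i j s) * (μ (t + 1 + 1) i s - μ (t + 1 + 1) j s)
          ≤ γ t * ∑ _s : Fin S, ∑ i, ∑ j ∈ Finset.univ.filter (fun j => G.Adj i j), M ^ 2 := by
        simp only [Finset.mul_sum]
        refine Finset.sum_le_sum fun s _ => Finset.sum_le_sum fun i _ =>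
          Finset.sum_le_sum fun j hj => ?_
        rw [hupdate t i j (Finset.mem_filter.1 hj).2 s, sub_sub_cancel_left, neg_mul, mul_assoc,
          ← mul_neg]
        refine mul_le_mul_of_nonneg_left ((neg_le_abs _).trans ?_) (hγ0 t)
        rw [abs_mul, sq]
        exact mul_le_mul (hμdiff t i j s) (hμdiff (t + 1) i j s) (abs_nonneg _) hM.le
      linarith
  refine (tendsto_add_atTop_iff_nat 1).1 ?_
  simpa using hlim.add_const fs
end
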